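/- Let N ≥ 2, let s, u, t, v ∈ ℂ be nonzero, λ = (λ_1,…,λ_N) ∈ ℝ^N, and let 𝐱, 𝐲 ∈ (ℂ∖{0})^N with the conventions x_{N+1} := s and y_0 := t. (i) For j = 1,…,N define the operator 𝒮^{(j)} on functions F : (ℂ∖{0})^N → ℂ by (𝒮^{(j)}F)(𝐳) := Σ_{i=1}^{j} (π_{λ_{N−j+i},0}(Y_{s,u}) applied in the variable z_{N−j+i} to the function obtained from F by replacing z_k by q²z_k for k = N−j+1,…,N−j+i−1), evaluated at 𝐳. Then for every 𝐳 at which all occurring functions are defined, (𝒮^{(j)} f_𝐱)(𝐳) = (μ_{x_{N−j+1}} − μ_s)·f_𝐱(𝐳), where f_𝐱(𝐳) := ∏_{j=1}^N f_{x_j, x_{j+1}, u, λ_j, 0}(z_j). (ii) For j = 1,…,N define the operator 𝒯^{(j)} by (𝒯^{(j)}F)(𝐳) := Σ_{i=1}^{j} (π_{λ_i,0}(Ỹ_{t,v}) applied in the variable z_i to the function obtained from F by replacing z_k by z_k/q² for k = i+1,…,j), evaluated at 𝐳. Then for every 𝐳 at which all occurring functions are defined, (𝒯^{(j)} f^ϑ_𝐲)(𝐳)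 = (μ_{y_j} − μ_t)·f^ϑ_𝐲(𝐳), where f^ϑ_𝐲(𝐳) := ∏_{i=1}^N f_{y_i, y_{i−1}, v, λ_i, 0}(1/z_i). -/

import Mathlib

noncomputable section

open Complex

/-- `q^{iλ} := exp(iλ · log q)`. -/
def qil (q lam : ℝ) : ℂ := Complex.exp (Complex.I * lam * Real.log q)

/-- the real power `q^a` viewed as a complex number. -/
def qr (q a : ℝ) : ℂ := ((q ^ a : ℝ) : ℂ)

/-- the infinite `q`-shifted factorial `(w;p)_∞ = ∏_{j≥0} (1 - w p^j)`. -/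
def qPoch (w p : ℂ) : ℂ := ∏' j : ℕ, (1 - w * p ^ j)

/-- the theta function `θ(w;p) = (w;p)_∞ (p/w;p)_∞`. -/
def qTheta (w p : ℂ) : ℂ := qPoch w p * qPoch (p / w) p

/-- `μ_s = (s + s⁻¹)/(q⁻¹ - q)`. -/
def mu (q : ℝ) (s : ℂ) : ℂ := (s + s⁻¹) / ((q : ℂ)⁻¹ - (q : ℂ))

/-- The eigenfunction
`f_{x,s,u,λ,ε}(z) = (sq^{1−2iλ}x^{±1}, uszq^{1+iλ};q²)_∞ θ(q^{2ε−iλ}uz/s;q²) /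
(uzq^{−iλ}x^{±1}, sq^{1−iλ}/(uz);q²)_∞`. -/
def fAW (q lam eps : ℝ) (x s u : ℂ) (z : ℂ) : ℂ :=
  (qPoch (s * (q : ℂ) * ((qil q lam)⁻¹) ^ 2 * x) ((q : ℂ) ^ 2) *
    qPoch (s * (q : ℂ) * ((qil q lam)⁻¹) ^ 2 / x) ((q : ℂ) ^ 2) *
    qPoch (u * s * z * (q : ℂ) * qil q lam) ((q : ℂ) ^ 2) *
    qTheta (qr q (2 * eps) * (qil q lam)⁻¹ * u * z / s) ((q : ℂ) ^ 2)) /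
  (qPoch (u * z * (qil q lam)⁻¹ * x) ((q : ℂ) ^ 2) *
    qPoch (u * z * (qil q lam)⁻¹ / x) ((q : ℂ) ^ 2) *
    qPoch (s * (q : ℂ) * (qil q lam)⁻¹ / (u * z)) ((q : ℂ) ^ 2))

/-- the denominator of `f_{x,s,u,λ,ε}` at the point `z`. -/
def fDen (q lam : ℝ) (x s u : ℂ) (z : ℂ) : ℂ :=
  qPoch (u * z * (qil q lam)⁻¹ * x) ((q : ℂ) ^ 2) *
    qPoch (u * z * (qil q lam)⁻¹ / x) ((q : ℂ) ^ 2) *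
    qPoch (s * (q : ℂ) * (qil q lam)⁻¹ / (u * z)) ((q : ℂ) ^ 2)

/-- `f_𝐱(𝐳) = ∏_{j=1}^N f_{x_j, x_{j+1}, u, λ_j, 0}(z_j)`. -/
def Fmulti (q : ℝ) (u : ℂ) (lam : ℕ → ℝ) (x : ℕ → ℂ) (N : ℕ) (z : ℕ → ℂ) : ℂ :=
  ∏ j ∈ Finset.Icc 1 N, fAW q (lam j) 0 (x j) (x (j + 1)) u (z j)

/-- replace `z_k` by `q²z_k` for `a ≤ k ≤ b`. -/
def scaleUp (q : ℝ) (a b : ℕ) (z : ℕ → ℂ) : ℕ → ℂ :=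
  fun k => if a ≤ k ∧ k ≤ b then (q : ℂ) ^ 2 * z k else z k

/-- replace `z_k` by `z_k/q²` for `a ≤ k ≤ b`. -/
def scaleDown (q : ℝ) (a b : ℕ) (z : ℕ → ℂ) : ℕ → ℂ :=
  fun k => if a ≤ k ∧ k ≤ b then z k / (q : ℂ) ^ 2 else z k

/-- apply `π_{λ,0}(Y_{s,u})` in the variable `z_m`. -/
def appY (q lam : ℝ) (s u : ℂ) (m : ℕ) (G : (ℕ → ℂ) → ℂ) (z : ℕ → ℂ) : ℂ :=
  ((s + s⁻¹ - u * z m * (q : ℂ) * qil q lam - u⁻¹ * (z m)⁻¹ * (q : ℂ)⁻¹ * (qil q lam)⁻¹) /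
      ((q : ℂ)⁻¹ - (q : ℂ))) * G (Function.update z m ((q : ℂ) ^ 2 * z m))
    + ((u * z m * (qil q lam)⁻¹ + u⁻¹ * (z m)⁻¹ * qil q lam - s - s⁻¹) /
      ((q : ℂ)⁻¹ - (q : ℂ))) * G z

/-- apply `π_{λ,0}(Ỹ_{t,w})` in the variable `z_m`. -/
def appYt (q lam : ℝ) (t w : ℂ) (m : ℕ) (G : (ℕ → ℂ) → ℂ) (z : ℕ → ℂ) : ℂ :=
  ((t + t⁻¹ - w⁻¹ * z m * (q : ℂ)⁻¹ * (qil q lam)⁻¹ - w * (z m)⁻¹ * (q : ℂ) * qil q lam) /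
      ((q : ℂ)⁻¹ - (q : ℂ))) * G (Function.update z m (z m / (q : ℂ) ^ 2))
    + ((w⁻¹ * z m * qil q lam + w * (z m)⁻¹ * (qil q lam)⁻¹ - t - t⁻¹) /
      ((q : ℂ)⁻¹ - (q : ℂ))) * G z

/-- the operator `𝒮^{(j)}`: the sum over `i = 1,…,j` of `π_{λ_{N−j+i},0}(Y_{s,u})`
applied in the variable `z_{N−j+i}` to the function obtained from `F` by replacing
`z_k` by `q²z_k` for `k = N−j+1,…,N−j+i−1`. -/
def opS (q : ℝ) (lam : ℕ → ℝ) (s u : ℂ) (N j : ℕ) (F : (ℕ → ℂ) → ℂ) (z : ℕ → ℂ) : ℂ :=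
  ∑ i ∈ Finset.Icc 1 j,
    appY q (lam (N - j + i)) s u (N - j + i)
      (fun w => F (scaleUp q (N - j + 1) (N - j + i - 1) w)) z

/-- the operator `𝒯^{(j)}`: the sum over `i = 1,…,j` of `π_{λ_i,0}(Ỹ_{t,w})`
applied in the variable `z_i` to the function obtained from `F` by replacing
`z_k` by `z_k/q²` for `k = i+1,…,j`. -/
def opT (q : ℝ) (lam : ℕ → ℝ) (t w : ℂ) (j : ℕ) (F : (ℕ → ℂ) → ℂ) (z : ℕ → ℂ) : ℂ :=
  ∑ i ∈ Finset.Icc 1 j,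
    appYt q (lam i) t w i (fun w' => F (scaleDown q (i + 1) j w')) z

/-- `f^ϑ_𝐲(𝐳) = ∏_{i=1}^N f_{y_i, y_{i−1}, v, λ_i, 0}(1/z_i)`. -/
def FmultiT (q : ℝ) (v : ℂ) (lam : ℕ → ℝ) (y : ℕ → ℂ) (N : ℕ) (z : ℕ → ℂ) : ℂ :=
  ∏ i ∈ Finset.Icc 1 N, fAW q (lam i) 0 (y i) (y (i - 1)) v (z i)⁻¹

lemma qPoch_step (w p : ℂ) (hp : ‖p‖ < 1) : qPoch w p = (1 - w) * qPoch (p * w) p := by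
  have hs : Summable (fun n : ℕ => ‖-(p * w * p ^ n)‖) := by
    have := (summable_geometric_of_lt_one (norm_nonneg p) hp).mul_left ‖p * w‖
    refine this.congr (fun n => ?_)
    rw [norm_neg, norm_mul (p * w), norm_pow]
  have hm : Multipliable (fun n : ℕ => (1 - p * w * p ^ n)) := by
    have := multipliable_one_add_of_summable hs
    simpa [sub_eq_add_neg] using this
  have hm' : Multipliable (fun n : ℕ => (1 - w * p ^ (n + 1))) := by
    refine hm.congr (fun n => ?_)
    ring
  have h0 := tprod_eq_zero_mul' (f := fun n : ℕ => 1 - w * p ^ n) hm'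
  have h1 : (∏' n : ℕ, (1 - w * p ^ (n + 1))) = ∏' n : ℕ, (1 - p * w * p ^ n) :=
    tprod_congr (fun n => by rw [pow_succ]; ring)
  unfold qPoch
  rw [h0, h1, pow_zero, mul_one]

lemma qil_ne (q lam : ℝ) : qil q lam ≠ 0 := Complex.exp_ne_zero _

/-- The basic one-variable first order `q`-difference equation. -/
lemma fAW_step (q : ℝ) (hq0 : 0 < q) (hq1 : q < 1) (lam : ℝ) (x s u z : ℂ)
    (hx : x ≠ 0) (hs : s ≠ 0) (hu : u ≠ 0) (hz : z ≠ 0)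
    (h1 : fDen q lam x s u z ≠ 0) (h2 : fDen q lam x s u ((q : ℂ) ^ 2 * z) ≠ 0) :
    (s + s⁻¹ - u * z * (q : ℂ) * qil q lam - u⁻¹ * z⁻¹ * (q : ℂ)⁻¹ * (qil q lam)⁻¹) *
        fAW q lam 0 x s u ((q : ℂ) ^ 2 * z)
      = (x + x⁻¹ - u * z * (qil q lam)⁻¹ - u⁻¹ * z⁻¹ * qil q lam) * fAW q lam 0 x s u z := by
  have hQ := qil_ne q lam
  have hq : (q : ℂ) ≠ 0 := by exact_mod_cast hq0.ne'
  have hp : ‖(q : ℂ) ^ 2‖ < 1 := by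
    rw [norm_pow, Complex.norm_real, Real.norm_of_nonneg hq0.le]
    nlinarith
  have hqr : qr q (2 * 0) = 1 := by simp [qr]
  unfold fDen at h1 h2
  unfold fAW qTheta
  rw [hqr]
  generalize qil q lam = Q at *
  generalize (q : ℂ) = r at *
  clear hqr
  have e1 := qPoch_step (u * s * z * r * Q) (r ^ 2) hp
  have e2 := qPoch_step (1 * Q⁻¹ * u * z / s) (r ^ 2) hp
  have e3 := qPoch_step (r ^ 2 / (1 * Q⁻¹ * u * (r ^ 2 * z) / s)) (r ^ 2) hp
  have e4 := qPoch_step (u * z * Q⁻¹ * x) (r ^ 2) hp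
  have e5 := qPoch_step (u * z * Q⁻¹ / x) (r ^ 2) hp
  have e6 := qPoch_step (s * r * Q⁻¹ / (u * (r ^ 2 * z))) (r ^ 2) hp
  rw [show r ^ 2 * (u * s * z * r * Q) = u * s * (r ^ 2 * z) * r * Q by ring] at e1
  rw [show r ^ 2 * (1 * Q⁻¹ * u * z / s) = 1 * Q⁻¹ * u * (r ^ 2 * z) / s by ring] at e2
  rw [show r ^ 2 * (r ^ 2 / (1 * Q⁻¹ * u * (r ^ 2 * z) / s)) = r ^ 2 / (1 * Q⁻¹ * u * z / s) by
    field_simp] at e3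
  rw [show r ^ 2 * (u * z * Q⁻¹ * x) = u * (r ^ 2 * z) * Q⁻¹ * x by ring] at e4
  rw [show r ^ 2 * (u * z * Q⁻¹ / x) = u * (r ^ 2 * z) * Q⁻¹ / x by ring] at e5
  rw [show r ^ 2 * (s * r * Q⁻¹ / (u * (r ^ 2 * z))) = s * r * Q⁻¹ / (u * z) by
    field_simp] at e6
  rw [e6] at h2 ⊢
  rw [e4, e5] at h1 ⊢
  rw [e1, e2, e3]
  generalize qPoch (u * s * (r ^ 2 * z) * r * Q) (r ^ 2) = A1 at *
  generalize qPoch (1 * Q⁻¹ * u * (r ^ 2 * z) / s) (r ^ 2) = A2 at *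
  generalize qPoch (r ^ 2 / (1 * Q⁻¹ * u * z / s)) (r ^ 2) = A3 at *
  generalize qPoch (u * (r ^ 2 * z) * Q⁻¹ * x) (r ^ 2) = A4 at *
  generalize qPoch (u * (r ^ 2 * z) * Q⁻¹ / x) (r ^ 2) = A5 at *
  generalize qPoch (s * r * Q⁻¹ / (u * z)) (r ^ 2) = A6 at *
  generalize qPoch (s * r * Q⁻¹ ^ 2 * x) (r ^ 2) = A7 at *
  generalize qPoch (s * r * Q⁻¹ ^ 2 / x) (r ^ 2) = A8 at *
  clear e1 e2 e3 e4 e5 e6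
  simp only [mul_ne_zero_iff] at h1 h2
  obtain ⟨⟨⟨h4, h4'⟩, h5, h5'⟩, h6⟩ := h1
  obtain ⟨-, h7, -⟩ := h2
  rw [mul_div_assoc', mul_div_assoc', div_eq_div_iff (by simp [*]) (by simp [*])]
  field_simp
  ring

lemma Fmulti_pt {N m : ℕ} (hm : m ∈ Finset.Icc 1 N) (g : ℕ → ℂ → ℂ) (w : ℕ → ℂ) (c : ℂ) :
    (∏ j ∈ Finset.Icc 1 N, g j (Function.update w m c j))
      = g m c * ∏ j ∈ (Finset.Icc 1 N).erase m, g j (w j) := by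
  rw [← Finset.mul_prod_erase _ _ hm, Function.update_self]
  congr 1
  refine Finset.prod_congr rfl (fun j hj => ?_)
  rw [Function.update_of_ne (Finset.ne_of_mem_erase hj)]

lemma scaleUp_update (q : ℝ) (a m : ℕ) (ham : a ≤ m) (hm : 1 ≤ m) (z : ℕ → ℂ) :
    scaleUp q a (m - 1) (Function.update z m ((q : ℂ) ^ 2 * z m)) = scaleUp q a m z := by
  funext k
  unfold scaleUp
  by_cases hk : k = m
  · subst hk
    rw [if_neg (by omega), if_pos (by omega), Function.update_self]
  · rw [Function.update_of_ne hk]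
    by_cases h : a ≤ k ∧ k ≤ m
    · simp only [if_pos h]; rw [if_pos (by omega)]
    · simp only [if_neg h]; rw [if_neg (by omega)]

lemma scaleUp_eq_update (q : ℝ) (a m : ℕ) (ham : a ≤ m) (hm : 1 ≤ m) (z : ℕ → ℂ) :
    scaleUp q a m z = Function.update (scaleUp q a (m - 1) z) m ((q : ℂ) ^ 2 * z m) := by
  funext k
  unfold scaleUp
  by_cases hk : k = m
  · subst hk
    rw [if_pos (by omega), Function.update_self]
  · rw [Function.update_of_ne hk]
    by_cases h : a ≤ k ∧ k ≤ m
    · simp only [if_pos h]; rw [if_pos (by omega)]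
    · simp only [if_neg h]; rw [if_neg (by omega)]

lemma scaleDown_update (q : ℝ) (m b : ℕ) (hmb : m ≤ b) (z : ℕ → ℂ) :
    scaleDown q (m + 1) b (Function.update z m (z m / (q : ℂ) ^ 2)) = scaleDown q m b z := by
  funext k
  unfold scaleDown
  by_cases hk : k = m
  · subst hk
    rw [if_neg (by omega), if_pos (by omega), Function.update_self]
  · rw [Function.update_of_ne hk]
    by_cases h : m ≤ k ∧ k ≤ b
    · simp only [if_pos h]; rw [if_pos (by omega)]
    · simp only [if_neg h]; rw [if_neg (by omega)]

lemma scaleDown_eq_update (q : ℝ) (m b : ℕ) (hmb : m ≤ b) (z : ℕ → ℂ) :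
    scaleDown q m b z
      = Function.update (scaleDown q (m + 1) b z) m (z m / (q : ℂ) ^ 2) := by
  funext k
  unfold scaleDown
  by_cases hk : k = m
  · subst hk
    rw [if_pos (by omega), Function.update_self]
  · rw [Function.update_of_ne hk]
    by_cases h : m ≤ k ∧ k ≤ b
    · simp only [if_pos h]; rw [if_pos (by omega)]
    · simp only [if_neg h]; rw [if_neg (by omega)]

lemma sum_tele (h : ℕ → ℂ) (j : ℕ) :
    ∑ i ∈ Finset.Icc 1 j, (h (i - 1) - h i) = h 0 - h j := by
  induction j with
  | zero => simp
  | succ n ih =>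
    rw [Finset.sum_Icc_succ_top (by omega), ih, Nat.add_sub_cancel]
    ring

lemma appY_term (q : ℝ) (hq0 : 0 < q) (hq1 : q < 1) (N : ℕ) (s u : ℂ) (hu : u ≠ 0)
    (lam : ℕ → ℝ) (x : ℕ → ℂ) (hx : ∀ i ∈ Finset.Icc 1 (N + 1), x i ≠ 0) (z : ℕ → ℂ)
    (hz : ∀ k ∈ Finset.Icc 1 N, z k ≠ 0 ∧
        fDen q (lam k) (x k) (x (k + 1)) u (z k) ≠ 0 ∧
        fDen q (lam k) (x k) (x (k + 1)) u ((q : ℂ) ^ 2 * z k) ≠ 0)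
    (a m : ℕ) (ham : a ≤ m) (hm : m ∈ Finset.Icc 1 N) :
    appY q (lam m) s u m (fun w => Fmulti q u lam x N (scaleUp q a (m - 1) w)) z
      = (mu q (x m) - mu q s) * Fmulti q u lam x N (scaleUp q a (m - 1) z)
        - (mu q (x (m + 1)) - mu q s) * Fmulti q u lam x N (scaleUp q a m z) := by
  have hm' := Finset.mem_Icc.mp hm
  obtain ⟨z0, d1, d2⟩ := hz m hm
  have key := fAW_step q hq0 hq1 (lam m) (x m) (x (m + 1)) u (z m) (hx m (by simp; omega))
    (hx (m + 1) (by simp; omega)) hu z0 d1 d2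
  unfold appY
  beta_reduce
  rw [scaleUp_update q a m ham hm'.1, scaleUp_eq_update q a m ham hm'.1]
  have hw : scaleUp q a (m - 1) z = Function.update (scaleUp q a (m - 1) z) m (z m) := by
    conv_lhs => rw [← Function.update_eq_self m (scaleUp q a (m - 1) z)]
    congr 1
    unfold scaleUp
    rw [if_neg (by omega)]
  have e2 : Fmulti q u lam x N (scaleUp q a (m - 1) z)
      = Fmulti q u lam x N (Function.update (scaleUp q a (m - 1) z) m (z m)) := by rw [← hw]
  rw [e2]
  unfold Fmulti
  rw [Fmulti_pt hm (fun j => fAW q (lam j) 0 (x j) (x (j + 1)) u),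
    Fmulti_pt hm (fun j => fAW q (lam j) 0 (x j) (x (j + 1)) u)]
  unfold mu
  linear_combination (∏ j ∈ (Finset.Icc 1 N).erase m,
    fAW q (lam j) 0 (x j) (x (j + 1)) u (scaleUp q a (m - 1) z j)) / ((q : ℂ)⁻¹ - q) * key

lemma appYt_term (q : ℝ) (hq0 : 0 < q) (hq1 : q < 1) (N : ℕ) (t v : ℂ) (hv : v ≠ 0)
    (lam : ℕ → ℝ) (y : ℕ → ℂ) (hy : ∀ i ≤ N, y i ≠ 0) (z : ℕ → ℂ)
    (hz : ∀ k ∈ Finset.Icc 1 N, z k ≠ 0 ∧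
        fDen q (lam k) (y k) (y (k - 1)) v ((z k)⁻¹) ≠ 0 ∧
        fDen q (lam k) (y k) (y (k - 1)) v ((z k / (q : ℂ) ^ 2)⁻¹) ≠ 0)
    (b m : ℕ) (hmb : m ≤ b) (hm : m ∈ Finset.Icc 1 N) :
    appYt q (lam m) t v m (fun w => FmultiT q v lam y N (scaleDown q (m + 1) b w)) z
      = (mu q (y m) - mu q t) * FmultiT q v lam y N (scaleDown q (m + 1) b z)
        - (mu q (y (m - 1)) - mu q t) * FmultiT q v lam y N (scaleDown q m b z) := by
  have hm' := Finset.mem_Icc.mp hm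
  obtain ⟨z0, d1, d2⟩ := hz m hm
  have hinv : (z m / (q : ℂ) ^ 2)⁻¹ = (q : ℂ) ^ 2 * (z m)⁻¹ := by
    rw [inv_div, div_eq_mul_inv]
  rw [hinv] at d2
  have key := fAW_step q hq0 hq1 (lam m) (y m) (y (m - 1)) v (z m)⁻¹ (hy m (by omega))
    (hy (m - 1) (by omega)) hv (inv_ne_zero z0) d1 d2
  rw [inv_inv] at key
  unfold appYt
  beta_reduce
  rw [scaleDown_update q m b hmb, scaleDown_eq_update q m b hmb]
  have hw : scaleDown q (m + 1) b z = Function.update (scaleDown q (m + 1) b z) m (z m) := by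
    conv_lhs => rw [← Function.update_eq_self m (scaleDown q (m + 1) b z)]
    congr 1
    unfold scaleDown
    rw [if_neg (by omega)]
  have e2 : FmultiT q v lam y N (scaleDown q (m + 1) b z)
      = FmultiT q v lam y N (Function.update (scaleDown q (m + 1) b z) m (z m)) := by rw [← hw]
  rw [e2]
  unfold FmultiT
  rw [Fmulti_pt hm (fun j c => fAW q (lam j) 0 (y j) (y (j - 1)) v c⁻¹),
    Fmulti_pt hm (fun j c => fAW q (lam j) 0 (y j) (y (j - 1)) v c⁻¹)]
  rw [hinv]
  unfold mu
  linear_combination (∏ j ∈ (Finset.Icc 1 N).erase m,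
    fAW q (lam j) 0 (y j) (y (j - 1)) v (scaleDown q (m + 1) b z j)⁻¹) / ((q : ℂ)⁻¹ - q) * key

/-- `f_𝐱` and `f^ϑ_𝐲` are simultaneous eigenfunctions of the operators
`𝒮^{(j)} = π(𝖸^{(j)}_{s,u})` and `𝒯^{(j)} = π(𝖸̃^{(j)}_{t,v})` respectively. -/
theorem stmt15 (q : ℝ) (hq0 : 0 < q) (hq1 : q < 1) (N : ℕ) (hN : 2 ≤ N)
    (s u t v : ℂ) (hs : s ≠ 0) (hu : u ≠ 0) (ht : t ≠ 0) (hv : v ≠ 0)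
    (lam : ℕ → ℝ) (x y : ℕ → ℂ)
    (hx : ∀ i ∈ Finset.Icc 1 N, x i ≠ 0) (hxN : x (N + 1) = s)
    (hy : ∀ i ∈ Finset.Icc 1 N, y i ≠ 0) (hy0 : y 0 = t) :
    (∀ j ∈ Finset.Icc 1 N, ∀ z : ℕ → ℂ,
      (∀ k ∈ Finset.Icc 1 N, z k ≠ 0 ∧
        fDen q (lam k) (x k) (x (k + 1)) u (z k) ≠ 0 ∧
        fDen q (lam k) (x k) (x (k + 1)) u ((q : ℂ) ^ 2 * z k) ≠ 0) →
      opS q lam s u N j (Fmulti q u lam x N) z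
        = (mu q (x (N - j + 1)) - mu q s) * Fmulti q u lam x N z) ∧
    (∀ j ∈ Finset.Icc 1 N, ∀ z : ℕ → ℂ,
      (∀ k ∈ Finset.Icc 1 N, z k ≠ 0 ∧
        fDen q (lam k) (y k) (y (k - 1)) v ((z k)⁻¹) ≠ 0 ∧
        fDen q (lam k) (y k) (y (k - 1)) v ((z k / (q : ℂ) ^ 2)⁻¹) ≠ 0) →
      opT q lam t v j (FmultiT q v lam y N) z
        = (mu q (y j) - mu q t) * FmultiT q v lam y N z) := by
  constructor
  · intro j hj z hz
    have hj' := Finset.mem_Icc.mp hj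
    have hx' : ∀ i ∈ Finset.Icc 1 (N + 1), x i ≠ 0 := by
      intro i hi
      have hi' := Finset.mem_Icc.mp hi
      by_cases h : i = N + 1
      · rw [h, hxN]; exact hs
      · exact hx i (Finset.mem_Icc.mpr (by omega))
    unfold opS
    let h : ℕ → ℂ := fun i => (mu q (x (N - j + i + 1)) - mu q s) *
      Fmulti q u lam x N (scaleUp q (N - j + 1) (N - j + i) z)
    have : ∀ i ∈ Finset.Icc 1 j, appY q (lam (N - j + i)) s u (N - j + i)
        (fun w => Fmulti q u lam x N (scaleUp q (N - j + 1) (N - j + i - 1) w)) z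
        = h (i - 1) - h i := by
      intro i hi
      have hi' := Finset.mem_Icc.mp hi
      rw [appY_term q hq0 hq1 N s u hu lam x hx' z hz (N - j + 1) (N - j + i) (by omega)
        (Finset.mem_Icc.mpr (by omega))]
      simp only [h]
      rw [show N - j + (i - 1) + 1 = N - j + i by omega,
        show N - j + (i - 1) = N - j + i - 1 by omega]
    rw [Finset.sum_congr rfl this, sum_tele]
    have h0 : scaleUp q (N - j + 1) (N - j + 0) z = z := by
      funext k
      unfold scaleUp
      rw [if_neg (by omega)]
    simp only [h]
    rw [h0, show N - j + j + 1 = N + 1 by omega, hxN]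
    simp
  · intro j hj z hz
    have hj' := Finset.mem_Icc.mp hj
    have hy' : ∀ i ≤ N, y i ≠ 0 := by
      intro i hi
      by_cases h : i = 0
      · rw [h, hy0]; exact ht
      · exact hy i (Finset.mem_Icc.mpr (by omega))
    unfold opT
    let h : ℕ → ℂ := fun i => -((mu q (y i) - mu q t) *
      FmultiT q v lam y N (scaleDown q (i + 1) j z))
    have : ∀ i ∈ Finset.Icc 1 j, appYt q (lam i) t v i
        (fun w' => FmultiT q v lam y N (scaleDown q (i + 1) j w')) z
        = h (i - 1) - h i := by
      intro i hi
      have hi' := Finset.mem_Icc.mp hi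
      rw [appYt_term q hq0 hq1 N t v hv lam y hy' z hz j i (by omega)
        (Finset.mem_Icc.mpr (by omega))]
      simp only [h]
      rw [show i - 1 + 1 = i by omega]
      ring
    rw [Finset.sum_congr rfl this, sum_tele]
    have h0 : scaleDown q (j + 1) j z = z := by
      funext k
      unfold scaleDown
      rw [if_neg (by omega)]
    simp only [h]
    rw [h0, hy0]
    ring

end
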